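/- arXiv:hep-th/9610066 — 6 statements merged into one kernel-verified Lean document; each statement's English description precedes it below -/
import Mathlib

section
/- Let ρ₁, ρ₂ be two commuting representations of the Virasoro algebra on a normed complex vector space V (Lie algebra homomorphisms into End(V) with [ρ₁(x), ρ₂(y)] = 0 for all x, y), and assume that for every v ∈ V there exists K such that ρ₂(Lₖ)v = 0 for all k ≥ K. For an integer n ≤ 0 and z₁ ≠ z₂ in ℂ define M₁(n, z₁, z₂)v := ρ₁(L_{n−2})v − (−1)ⁿ Σ_{k≥1} C(k−1−n, k−1)·(z₁−z₂)^{n−k}·ρ₂(L_{k−2})v, where C(·,·) denotes the binomial coefficient (the sum is finite by assumption). Then for every v ∈ V, every integer n ≤ 0 and fixed z₂, the map z₁ ↦ M₁(n, z₁, z₂)v is differentiable on ℂ ∖ {z₂} and satisfies ∂_{z₁}(M₁(n, z₁, z₂)v) + ρ₁(L₋₁)(M₁(n, z₁, z₂)v) − M₁(n, z₁, z₂)(ρ₁(L₋₁)v) = (1−n)·M₁(n−1, z₁, z₂)v. -/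
/-- The operator `M₁(L_{n-2})` built from two commuting Virasoro actions at insertion
points `z₁, z₂`:
`M₁(n, z₁, z₂)v = ρ₁(L_{n-2})v - (-1)ⁿ ∑_{k≥1} C(k-1-n, k-1)(z₁-z₂)^{n-k} ρ₂(L_{k-2})v`
(the sum, written below over `j = k - 1 : ℕ`, is finite whenever `ρ₂` acts smoothly). -/
noncomputable def genKZM {V : Type*} [NormedAddCommGroup V] [NormedSpace ℂ V]
    (ρ₁ ρ₂ : ℤ → Module.End ℂ V) (n : ℤ) (z₁ z₂ : ℂ) (v : V) : V :=
  ρ₁ (n - 2) v -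
    (-1 : ℂ) ^ n •
      ∑' j : ℕ, ((((j : ℤ) - n).toNat.choose j : ℂ) * (z₁ - z₂) ^ (n - (j + 1 : ℤ))) •
        ρ₂ ((j : ℤ) - 1) v

theorem genKZM_eq_sum_aux {V : Type*} [NormedAddCommGroup V] [NormedSpace ℂ V]
    (ρ₁ ρ₂ : ℤ → Module.End ℂ V) (v : V) (N : ℕ)
    (hN : ∀ j : ℕ, N ≤ j → ρ₂ ((j : ℤ) - 1) v = 0) (n : ℤ) (z₁ z₂ : ℂ) :
    genKZM ρ₁ ρ₂ n z₁ z₂ v = ρ₁ (n - 2) v -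
    (-1 : ℂ) ^ n •
      ∑ j ∈ Finset.range N,
        ((((j : ℤ) - n).toNat.choose j : ℂ) * (z₁ - z₂) ^ (n - (j + 1 : ℤ))) •
        ρ₂ ((j : ℤ) - 1) v := by
  unfold genKZM
  rw [tsum_eq_sum]
  intro j hj
  rw [hN j (by simpa using hj), smul_zero]

theorem genKZM_choose_aux (j : ℕ) (n : ℤ) (hn : n ≤ 0) :
    ((((j : ℤ) - n).toNat.choose j : ℂ)) * ((n : ℂ) - (j + 1)) =
      - ((1 - n : ℂ) * (((j : ℤ) - (n - 1)).toNat.choose j : ℂ)) := by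
  obtain ⟨m, rfl⟩ : ∃ m : ℕ, n = -(m : ℤ) := ⟨n.toNat + (-n).toNat, by omega⟩
  have h1 : ((j : ℤ) - (-(m : ℤ))).toNat = j + m := by omega
  have h2 : ((j : ℤ) - (-(m : ℤ) - 1)).toNat = j + m + 1 := by omega
  rw [h1, h2]
  have h := Nat.choose_mul_succ_eq (j + m) j
  have h3 : j + m + 1 - j = m + 1 := by omega
  rw [h3] at h
  have hcast : (((j + m).choose j : ℕ) : ℂ) * (j + m + 1) = ((j + m + 1).choose j : ℕ) * (m + 1) := by
    exact_mod_cast h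
  push_cast
  linear_combination -hcast

/-- Covariance law for the generalized KZ operators (diagonal case `i = j = 1`,
Virasoro field, `N = 2` insertion points): for two commuting Virasoro representations
`ρ₁, ρ₂` on a normed complex vector space, with `ρ₂` acting smoothly, the map
`z₁ ↦ M₁(n, z₁, z₂)v` is differentiable away from `z₂` and
`∂₁ M₁(n)v + [ρ₁(L₋₁), M₁(n)] v = (1-n) M₁(n-1)v`. -/
theorem genKZ_covariance_law_diagonal
    {V : Type*} [NormedAddCommGroup V] [NormedSpace ℂ V]
    (ρ₁ ρ₂ : ℤ → Module.End ℂ V) (c₁ c₂ : ℂ)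
    (hrep₁ : ∀ n m : ℤ, ⁅ρ₁ n, ρ₁ m⁆ =
      ((n - m : ℤ) : ℂ) • ρ₁ (n + m) +
        (if n + m = 0 then ((n ^ 3 - n : ℤ) : ℂ) / 12 * c₁ else 0) • (1 : Module.End ℂ V))
    (hrep₂ : ∀ n m : ℤ, ⁅ρ₂ n, ρ₂ m⁆ =
      ((n - m : ℤ) : ℂ) • ρ₂ (n + m) +
        (if n + m = 0 then ((n ^ 3 - n : ℤ) : ℂ) / 12 * c₂ else 0) • (1 : Module.End ℂ V))
    (hcomm : ∀ n m : ℤ, Commute (ρ₁ n) (ρ₂ m))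
    (hsmooth : ∀ v : V, ∃ K : ℤ, ∀ k : ℤ, K ≤ k → ρ₂ k v = 0) :
    ∀ (v : V) (n : ℤ), n ≤ 0 → ∀ z₂ : ℂ,
      DifferentiableOn ℂ (fun z₁ => genKZM ρ₁ ρ₂ n z₁ z₂ v) {z₂}ᶜ ∧
      ∀ z₁ : ℂ, z₁ ≠ z₂ →
        deriv (fun w => genKZM ρ₁ ρ₂ n w z₂ v) z₁
            + ρ₁ (-1) (genKZM ρ₁ ρ₂ n z₁ z₂ v)
            - genKZM ρ₁ ρ₂ n z₁ z₂ (ρ₁ (-1) v)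
          = ((1 - n : ℤ) : ℂ) • genKZM ρ₁ ρ₂ (n - 1) z₁ z₂ v := by
  intro v n hn z₂
  obtain ⟨K, hK⟩ := hsmooth v
  have hN : ∀ j : ℕ, (K + 1).toNat ≤ j → ρ₂ ((j : ℤ) - 1) v = 0 := by
    intro j hj
    exact hK _ (by omega)
  generalize (K + 1).toNat = N at hN
  have hc : ∀ k : ℤ, ρ₂ k (ρ₁ (-1) v) = ρ₁ (-1) (ρ₂ k v) := by
    intro k
    have := LinearMap.congr_fun (hcomm (-1) k).eq v
    simpa using this.symm
  have hNcomm : ∀ j : ℕ, N ≤ j → ρ₂ ((j : ℤ) - 1) (ρ₁ (-1) v) = 0 := by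
    intro j hj
    rw [hc, hN j hj, map_zero]
  have hd : ∀ z₁ : ℂ, z₁ ≠ z₂ → HasDerivAt (fun w => genKZM ρ₁ ρ₂ n w z₂ v)
      (-((-1 : ℂ) ^ n • ∑ j ∈ Finset.range N,
        ((((j : ℤ) - n).toNat.choose j : ℂ) *
          (((n - (j + 1 : ℤ) : ℤ) : ℂ) * (z₁ - z₂) ^ (n - (j + 1 : ℤ) - 1))) •
        ρ₂ ((j : ℤ) - 1) v)) z₁ := by
    intro z₁ hz
    simp_rw [genKZM_eq_sum_aux ρ₁ ρ₂ v N hN]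
    refine HasDerivAt.const_sub _ (HasDerivAt.const_smul _ (HasDerivAt.fun_sum fun j _ => ?_))
    refine HasDerivAt.smul_const (HasDerivAt.const_mul _ ?_) _
    have h := (hasDerivAt_zpow (n - (j + 1 : ℤ)) (z₁ - z₂) (Or.inl (sub_ne_zero.2 hz)))
    exact h.comp_sub_const z₁ z₂
  refine ⟨fun z hz => (hd z hz).differentiableAt.differentiableWithinAt, fun z₁ hz => ?_⟩
  rw [(hd z₁ hz).deriv, genKZM_eq_sum_aux ρ₁ ρ₂ v N hN, genKZM_eq_sum_aux ρ₁ ρ₂ v N hN,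
    genKZM_eq_sum_aux ρ₁ ρ₂ _ N hNcomm]
  have hb : ρ₁ (-1) (ρ₁ (n - 2) v) - ρ₁ (n - 2) (ρ₁ (-1) v) =
      ((1 - n : ℤ) : ℂ) • ρ₁ (n - 1 - 2) v := by
    have h := LinearMap.congr_fun (hrep₁ (-1) (n - 2)) v
    rw [if_neg (by omega), Ring.lie_def] at h
    have e1 : (-1 : ℤ) + (n - 2) = n - 1 - 2 := by ring
    have e2 : (-1 : ℤ) - (n - 2) = 1 - n := by ring
    rw [e1, e2] at h
    simpa using h
  have hs : -((-1 : ℂ) ^ n • ∑ j ∈ Finset.range N,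
        ((((j : ℤ) - n).toNat.choose j : ℂ) *
          (((n - (j + 1 : ℤ) : ℤ) : ℂ) * (z₁ - z₂) ^ (n - (j + 1 : ℤ) - 1))) •
        ρ₂ ((j : ℤ) - 1) v) = -(((1 - n : ℤ) : ℂ) • ((-1 : ℂ) ^ (n - 1) •
      ∑ j ∈ Finset.range N,
        ((((j : ℤ) - (n - 1)).toNat.choose j : ℂ) * (z₁ - z₂) ^ (n - 1 - (j + 1 : ℤ))) •
        ρ₂ ((j : ℤ) - 1) v)) := by
    congr 1
    simp only [Finset.smul_sum, smul_smul]
    refine Finset.sum_congr rfl fun j _ => ?_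
    congr 1
    have e : n - (j + 1 : ℤ) - 1 = n - 1 - (j + 1 : ℤ) := by ring
    rw [e, zpow_sub_one₀ (by norm_num : (-1 : ℂ) ≠ 0) n]
    have h := genKZM_choose_aux j n hn
    push_cast
    have e3 : ((-1 : ℂ))⁻¹ = -1 := by norm_num
    rw [e3]
    linear_combination (-1 : ℂ) ^ n * (z₁ - z₂) ^ (n - 1 - (j + 1 : ℤ)) * h
  rw [hs, smul_sub, ← hb]
  simp only [map_sub, map_smul, map_sum, hc]
  abel
end

section
/- Let ρ₁, ρ₂ be two commuting representations of the Virasoro algebra on a normed complex vector space V (Lie algebra homomorphisms into End(V) with [ρ₁(x), ρ₂(y)] = 0 for all x, y), and assume that for every v ∈ V there exists K such that ρ₂(Lₖ)v = 0 for all k ≥ K. For an integer n ≤ 0 and z₁ ≠ z₂ in ℂ define M₁(n, z₁, z₂)v := ρ₁(L_{n−2})v − (−1)ⁿ Σ_{k≥1} C(k−1−n, k−1)·(z₁−z₂)^{n−k}·ρ₂(L_{k−2})v, where C(·,·) denotes the binomial coefficient (the sum is finite by assumption). Then for every v ∈ V, every integer n ≤ 0 and fixed z₁, the map z₂ ↦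 M₁(n, z₁, z₂)v is differentiable on ℂ ∖ {z₁} and satisfies ∂_{z₂}(M₁(n, z₁, z₂)v) + ρ₂(L₋₁)(M₁(n, z₁, z₂)v) − M₁(n, z₁, z₂)(ρ₂(L₋₁)v) = 0. -/
theorem genKZM_eq_sum {V : Type*} [NormedAddCommGroup V] [NormedSpace ℂ V]
    (ρ₁ ρ₂ : ℤ → Module.End ℂ V) (m : ℕ) (z₁ z₂ : ℂ) (v : V) (N : ℕ)
    (hN : ∀ j : ℕ, N ≤ j → ρ₂ ((j : ℤ) - 1) v = 0) :
    genKZM ρ₁ ρ₂ (-(m : ℤ)) z₁ z₂ v = ρ₁ (-(m : ℤ) - 2) v - (-1 : ℂ) ^ (-(m : ℤ)) •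
      ∑ j ∈ Finset.range N, (((j + m).choose j : ℂ) * (z₁ - z₂) ^ (-((m + j + 1 : ℕ) : ℤ))) •
        ρ₂ ((j : ℤ) - 1) v := by
  unfold genKZM
  rw [tsum_eq_sum (s := Finset.range N)]
  · congr 2
    refine Finset.sum_congr rfl fun j _ => ?_
    have h1 : ((j : ℤ) - -(m : ℤ)).toNat = j + m := by omega
    have h2 : (-(m : ℤ) - ((j : ℤ) + 1)) = -((m + j + 1 : ℕ) : ℤ) := by push_cast; ring
    rw [h1, h2]
  · intro j hj
    rw [hN j (by simpa using hj), smul_zero]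

theorem genKZ_hasDerivAt_coeff (p : ℕ) (a z₁ z₂ : ℂ) (h : z₂ ≠ z₁) :
    HasDerivAt (fun w : ℂ => a * (z₁ - w) ^ (-(p : ℤ)))
      (a * (p * (z₁ - z₂) ^ (-((p + 1 : ℕ) : ℤ)))) z₂ := by
  have h0 : z₁ - z₂ ≠ 0 := sub_ne_zero.mpr h.symm
  have h1 := (hasDerivAt_zpow (-(p : ℤ)) (z₁ - z₂) (Or.inl h0)).comp z₂
    ((hasDerivAt_id z₂).const_sub z₁)
  have h2 := h1.const_mul a
  refine h2.congr_deriv ?_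
  have h3 : -(p : ℤ) - 1 = -((p + 1 : ℕ) : ℤ) := by push_cast; ring
  rw [h3]
  push_cast
  ring

/-- Covariance law for the generalized KZ operators (off-diagonal case `i = 1`, `j = 2`,
Virasoro field, `N = 2` insertion points): for two commuting Virasoro representations
`ρ₁, ρ₂` on a normed complex vector space, with `ρ₂` acting smoothly, the map
`z₂ ↦ M₁(n, z₁, z₂)v` is differentiable away from `z₁` and
`∂₂ M₁(n)v + [ρ₂(L₋₁), M₁(n)] v = 0`. -/
theorem genKZ_covariance_law_offdiagonal
    {V : Type*} [NormedAddCommGroup V] [NormedSpace ℂ V]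
    (ρ₁ ρ₂ : ℤ → Module.End ℂ V) (c₁ c₂ : ℂ)
    (hrep₁ : ∀ n m : ℤ, ⁅ρ₁ n, ρ₁ m⁆ =
      ((n - m : ℤ) : ℂ) • ρ₁ (n + m) +
        (if n + m = 0 then ((n ^ 3 - n : ℤ) : ℂ) / 12 * c₁ else 0) • (1 : Module.End ℂ V))
    (hrep₂ : ∀ n m : ℤ, ⁅ρ₂ n, ρ₂ m⁆ =
      ((n - m : ℤ) : ℂ) • ρ₂ (n + m) +
        (if n + m = 0 then ((n ^ 3 - n : ℤ) : ℂ) / 12 * c₂ else 0) • (1 : Module.End ℂ V))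
    (hcomm : ∀ n m : ℤ, Commute (ρ₁ n) (ρ₂ m))
    (hsmooth : ∀ v : V, ∃ K : ℤ, ∀ k : ℤ, K ≤ k → ρ₂ k v = 0) :
    ∀ (v : V) (n : ℤ), n ≤ 0 → ∀ z₁ : ℂ,
      DifferentiableOn ℂ (fun z₂ => genKZM ρ₁ ρ₂ n z₁ z₂ v) {z₁}ᶜ ∧
      ∀ z₂ : ℂ, z₂ ≠ z₁ →
        deriv (fun w => genKZM ρ₁ ρ₂ n z₁ w v) z₂
            + ρ₂ (-1) (genKZM ρ₁ ρ₂ n z₁ z₂ v)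
            - genKZM ρ₁ ρ₂ n z₁ z₂ (ρ₂ (-1) v)
          = 0 := by
  intro v n hn z₁
  obtain ⟨m, rfl⟩ : ∃ m : ℕ, n = -(m : ℤ) := ⟨n.natAbs, by omega⟩
  obtain ⟨K, hK⟩ := hsmooth v
  obtain ⟨K', hK'⟩ := hsmooth (ρ₂ (-1) v)
  obtain ⟨N, hN1, hN2⟩ : ∃ N : ℕ, K + 1 ≤ N ∧ K' + 1 ≤ N :=
    ⟨(max (K + 1) (K' + 1)).toNat, by omega, by omega⟩
  have hv : ∀ j : ℕ, N ≤ j → ρ₂ ((j : ℤ) - 1) v = 0 := fun j hj => hK _ (by omega)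
  have hv' : ∀ j : ℕ, N ≤ j → ρ₂ ((j : ℤ) - 1) (ρ₂ (-1) v) = 0 := fun j hj => hK' _ (by omega)
  have hder : ∀ z₂ : ℂ, z₂ ≠ z₁ → HasDerivAt (fun w => genKZM ρ₁ ρ₂ (-(m : ℤ)) z₁ w v)
      (-((-1 : ℂ) ^ (-(m : ℤ)) • ∑ j ∈ Finset.range N, (((j + m).choose j : ℂ) *
        (((m + j + 1 : ℕ) : ℂ) * (z₁ - z₂) ^ (-((m + j + 1 + 1 : ℕ) : ℤ)))) •
          ρ₂ ((j : ℤ) - 1) v)) z₂ := by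
    intro z₂ hz
    simp_rw [fun w => genKZM_eq_sum ρ₁ ρ₂ m z₁ w v N hv]
    refine HasDerivAt.const_sub _ (HasDerivAt.fun_const_smul _ (HasDerivAt.fun_sum fun j _ => ?_))
    exact (genKZ_hasDerivAt_coeff (m + j + 1) _ z₁ z₂ hz).smul_const _
  refine ⟨fun z₂ hz => (hder z₂ hz).differentiableAt.differentiableWithinAt, fun z₂ hz => ?_⟩
  rw [(hder z₂ hz).deriv, genKZM_eq_sum ρ₁ ρ₂ m z₁ z₂ v (N + 1) fun j hj => hv j (by omega),
    genKZM_eq_sum ρ₁ ρ₂ m z₁ z₂ (ρ₂ (-1) v) (N + 1) fun j hj => hv' j (by omega)]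
  have hc : ρ₁ (-(m : ℤ) - 2) (ρ₂ (-1) v) = ρ₂ (-1) (ρ₁ (-(m : ℤ) - 2) v) :=
    LinearMap.congr_fun (hcomm (-(m : ℤ) - 2) (-1)).eq v
  have hbr : ∀ j : ℕ, ρ₂ (-1) (ρ₂ ((j : ℤ) - 1) v) =
      ρ₂ ((j : ℤ) - 1) (ρ₂ (-1) v) - (j : ℂ) • ρ₂ ((j : ℤ) - 2) v := by
    intro j
    have h := LinearMap.congr_fun (hrep₂ (-1) ((j : ℤ) - 1)) v
    have e : (-1 : ℤ) + ((j : ℤ) - 1) = (j : ℤ) - 2 := by ring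
    rw [e] at h
    simp [Ring.lie_def] at h
    rw [sub_eq_iff_eq_add] at h
    rw [h]
    module
  have key : ∑ j ∈ Finset.range (N + 1),
      (((j + m).choose j : ℂ) * (z₁ - z₂) ^ (-((m + j + 1 : ℕ) : ℤ))) •
        ((j : ℂ) • ρ₂ ((j : ℤ) - 2) v) =
      ∑ j ∈ Finset.range N, (((j + m).choose j : ℂ) *
        (((m + j + 1 : ℕ) : ℂ) * (z₁ - z₂) ^ (-((m + j + 1 + 1 : ℕ) : ℤ)))) •
          ρ₂ ((j : ℤ) - 1) v := by
    rw [Finset.sum_range_succ']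
    simp only [Nat.cast_zero, zero_smul, smul_zero, add_zero]
    refine Finset.sum_congr rfl fun j _ => ?_
    have e : ((j + 1 : ℕ) : ℤ) - 2 = (j : ℤ) - 1 := by push_cast; ring
    have hb : ((j + 1 + m).choose (j + 1) : ℂ) * ((j + 1 : ℕ) : ℂ) =
        ((j + m).choose j : ℂ) * ((m + j + 1 : ℕ) : ℂ) := by
      have := Nat.add_one_mul_choose_eq (j + m) j
      have e2 : j + 1 + m = j + m + 1 := by ring
      have e3 : m + j + 1 = j + m + 1 := by ring
      rw [e2, e3]
      exact_mod_cast (this.symm.trans (mul_comm _ _))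
    rw [e, smul_smul, ← mul_assoc, ← hb]
    congr 1
    rw [← add_assoc m j 1]
    ring
  rw [← key, map_sub, map_smul, map_sum, hc]
  simp only [map_smul, hbr, smul_sub, Finset.sum_sub_distrib]
  abel
end

section
/- Let p, q ∈ ℂ with pq ≠ 0, and set h := ((2p−q)² − (p−q)²)/(4pq), c := 1 − 6(p−q)²/(pq), and α := 2(2h+1)/3. Let ρ be a representation of the Virasoro algebra on a complex vector space V with central charge c (the central element C acts as c·id), and let v ∈ V be a highest weight vector of weight h, i.e. ρ(L₀)v = h·v and ρ(Lₙ)v = 0 for all n ≥ 1. Then the vector w := ρ(L₋₁)(ρ(L₋₁)v) − α·ρ(L₋₂)v satisfies ρ(Lₙ)w = 0 for all n ≥ 1, and ρ(L₀)w = (h+2)·w. -/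
/-- The level-two singular vector of the `(r,s) = (2,1)` degenerate Virasoro module:
with `h = ((2p-q)² - (p-q)²)/(4pq)`, `c = 1 - 6(p-q)²/(pq)` and `α = 2(2h+1)/3`, if
`v` is a highest weight vector of weight `h` in a representation of the Virasoro
algebra with central charge `c`, then `w = L₋₁(L₋₁ v) - α • L₋₂ v` is again a highest
weight (singular) vector, of weight `h + 2`. -/
theorem virasoro_level_two_singular_vector
    {V : Type*} [AddCommGroup V] [Module ℂ V]
    (p q : ℂ) (hpq : p * q ≠ 0)
    (h c α : ℂ)
    (hh : h = ((2 * p - q) ^ 2 - (p - q) ^ 2) / (4 * p * q))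
    (hc : c = 1 - 6 * (p - q) ^ 2 / (p * q))
    (hα : α = 2 * (2 * h + 1) / 3)
    (L : ℤ → Module.End ℂ V)
    (hrep : ∀ n m : ℤ, ⁅L n, L m⁆ =
      ((n - m : ℤ) : ℂ) • L (n + m) +
        (if n + m = 0 then ((n ^ 3 - n : ℤ) : ℂ) / 12 * c else 0) • (1 : Module.End ℂ V))
    (v : V) (h0 : L 0 v = h • v) (hhw : ∀ n : ℤ, 1 ≤ n → L n v = 0) :
    (∀ n : ℤ, 1 ≤ n → L n (L (-1) (L (-1) v) - α • L (-2) v) = 0) ∧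
      L 0 (L (-1) (L (-1) v) - α • L (-2) v)
        = (h + 2) • (L (-1) (L (-1) v) - α • L (-2) v) := by
  have key : ∀ (n m : ℤ) (x : V), L n (L m x) = L m (L n x) + (((n - m : ℤ) : ℂ) • L (n + m) x +
        (if n + m = 0 then ((n ^ 3 - n : ℤ) : ℂ) / 12 * c else 0) • x) := by
    intro n m x
    have e := congrArg (fun f : Module.End ℂ V => f x) (hrep n m)
    simp only [Ring.lie_def, LinearMap.sub_apply, LinearMap.add_apply, LinearMap.smul_apply,
      Module.End.mul_apply, Module.End.one_apply] at e
    rw [← e]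
    abel
  have hp : p ≠ 0 := left_ne_zero_of_mul hpq
  have hq : q ≠ 0 := right_ne_zero_of_mul hpq
  have h3 : 6 * h = α * (4 * h + c / 2) := by
    subst hα hc hh
    field_simp
    ring
  have h4 : 4 * h + 2 = 3 * α := by
    subst hα
    ring
  have z1 : L 1 v = 0 := hhw 1 le_rfl
  have z2 : L 2 v = 0 := hhw 2 (by norm_num)
  have a01 : L 0 (L (-1) v) = (h + 1) • L (-1) v := by
    rw [key, h0]
    norm_num
    module
  have a02 : L 0 (L (-2) v) = (h + 2) • L (-2) v := by
    rw [key, h0]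
    norm_num
    module
  have a11 : L 1 (L (-1) v) = (2 * h) • v := by
    rw [key, z1]
    norm_num [h0]
    module
  have gen : ∀ n : ℤ, 2 ≤ n → L n (L (-1) v) = ((n + 1 : ℤ) : ℂ) • L (n - 1) v := by
    intro n hn
    rw [key, hhw n (by omega), if_neg (by omega)]
    simp [sub_eq_add_neg]
  have genz : ∀ n : ℤ, 2 ≤ n → L n (L (-1) v) = 0 := by
    intro n hn
    rw [gen n hn, hhw (n - 1) (by omega), smul_zero]
  refine ⟨?_, ?_⟩
  · intro n hn
    rw [map_sub, map_smul]
    obtain rfl | rfl | hn3 : n = 1 ∨ n = 2 ∨ 3 ≤ n := by omega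
    · have b1 : L 1 (L (-1) (L (-1) v)) = (4 * h + 2) • L (-1) v := by
        rw [key, a11]
        norm_num [a01]
        module
      have b2 : L 1 (L (-2) v) = (3 : ℂ) • L (-1) v := by
        rw [key, z1]
        norm_num
      rw [b1, b2, h4]
      module
    · have b1 : L 2 (L (-1) (L (-1) v)) = (6 * h) • v := by
        rw [key, genz 2 le_rfl]
        norm_num [a11]
        module
      have b2 : L 2 (L (-2) v) = (4 * h + c / 2) • v := by
        rw [key, z2]
        norm_num [h0]
        module
      rw [b1, b2, h3]
      module
    · rw [key n (-1), genz n (by omega), if_neg (by omega), key n (-2), hhw n hn,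
        if_neg (by omega), hhw (n + -2) (by omega), genz (n + -1) (by omega)]
      simp
  · rw [map_sub, map_smul, a02, key, a01]
    norm_num [a01]
    module
end

section
/- Fix α, h ∈ ℂ. For z₁ ≠ z₂ in ℂ let A₁(z₁,z₂) and A₂(z₁,z₂) be the 4×4 complex matrices (rows/columns indexed 1–4) whose only nonzero entries are: A₁[1,3]=1, A₁[2,4]=1, A₁[3,1]=αh/(z₁−z₂)², A₁[3,2]=α/(z₁−z₂), A₁[4,1]=(α+2)αh/(z₁−z₂)³, A₁[4,2]=α(h+1)/(z₁−z₂)², A₁[4,3]=−α²/(z₁−z₂)²; and A₂[1,2]=1, A₂[2,1]=αh/(z₂−z₁)², A₂[2,3]=α/(z₂−z₁), A₂[3,4]=1, A₂[4,1]=(α+2)αh/(z₂−z₁)³, A₂[4,2]=−α²/(z₂−z₁)², A₂[4,3]=α(h+1)/(z₂−z₁)². Let D(z₁,z₂) := diag(1, z₁−z₂, z₁−z₂, (z₁−z₂)²). Then for all z₁ ≠ z₂: D·A₁·D⁻¹ = (z₁−z₂)⁻¹·R₁ and D·A₂·D⁻¹ = (z₁−z₂)⁻¹·R₂, where R₁ and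 R₂ are the constant matrices with nonzero entries R₁[1,3]=1, R₁[2,4]=1, R₁[3,1]=αh, R₁[3,2]=α, R₁[4,1]=α(α+2)h, R₁[4,2]=α(h+1), R₁[4,3]=−α²; and R₂[1,2]=1, R₂[2,1]=αh, R₂[2,3]=−α, R₂[3,4]=1, R₂[4,1]=−α(α+2)h, R₂[4,2]=−α², R₂[4,3]=α(h+1). -/
/-- First connection matrix of the generalized KZ connection for two-point blocks of
two Virasoro `(2,1)`-modules (eq. (14) of the paper). -/
noncomputable def genKZA₁ (α h z₁ z₂ : ℂ) : Matrix (Fin 4) (Fin 4) ℂ :=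
  !![0, 0, 1, 0;
     0, 0, 0, 1;
     α * h / (z₁ - z₂) ^ 2, α / (z₁ - z₂), 0, 0;
     (α + 2) * α * h / (z₁ - z₂) ^ 3, α * (h + 1) / (z₁ - z₂) ^ 2,
       -α ^ 2 / (z₁ - z₂) ^ 2, 0]

/-- Second connection matrix of the generalized KZ connection for two-point blocks of
two Virasoro `(2,1)`-modules (eq. (15) of the paper). -/
noncomputable def genKZA₂ (α h z₁ z₂ : ℂ) : Matrix (Fin 4) (Fin 4) ℂ :=
  !![0, 1, 0, 0;
     α * h / (z₂ - z₁) ^ 2, 0, α / (z₂ - z₁), 0;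
     0, 0, 0, 1;
     (α + 2) * α * h / (z₂ - z₁) ^ 3, -α ^ 2 / (z₂ - z₁) ^ 2,
       α * (h + 1) / (z₂ - z₁) ^ 2, 0]

/-- The gauge transformation `D₁₂(z) = (z₁ - z₂)^{d₁ + d₂}` of eq. (17),
with energy grades `(0,0), (0,1), (1,0), (1,1)`. -/
noncomputable def genKZD (z₁ z₂ : ℂ) : Matrix (Fin 4) (Fin 4) ℂ :=
  Matrix.diagonal ![1, z₁ - z₂, z₁ - z₂, (z₁ - z₂) ^ 2]

/-- After the gauge transformation by `D₁₂`, the generalized KZ connection matrices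
have at most simple poles at `z₁ = z₂` with constant residue (Proposition 3 of the
paper, `N = 2` instance): `D A₁ D⁻¹ = (z₁-z₂)⁻¹ • R₁` and `D A₂ D⁻¹ = (z₁-z₂)⁻¹ • R₂`
for constant matrices `R₁, R₂`. -/
theorem genKZ_gauge_transformed_simple_pole (α h : ℂ) :
    ∀ z₁ z₂ : ℂ, z₁ ≠ z₂ →
      genKZD z₁ z₂ * genKZA₁ α h z₁ z₂ * (genKZD z₁ z₂)⁻¹
        = (z₁ - z₂)⁻¹ •
            !![0, 0, 1, 0;
               0, 0, 0, 1;
               α * h, α, 0, 0;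
               α * (α + 2) * h, α * (h + 1), -α ^ 2, 0] ∧
      genKZD z₁ z₂ * genKZA₂ α h z₁ z₂ * (genKZD z₁ z₂)⁻¹
        = (z₁ - z₂)⁻¹ •
            !![0, 1, 0, 0;
               α * h, 0, -α, 0;
               0, 0, 0, 1;
               -(α * (α + 2) * h), -α ^ 2, α * (h + 1), 0] := by
  intro z₁ z₂ hne
  have hz : z₁ - z₂ ≠ 0 := sub_ne_zero.mpr hne
  have hswap : z₂ - z₁ = -(z₁ - z₂) := by ring
  have hinv : (genKZD z₁ z₂)⁻¹ = Matrix.diagonal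
      ![1, (z₁ - z₂)⁻¹, (z₁ - z₂)⁻¹, ((z₁ - z₂) ^ 2)⁻¹] := by
    apply Matrix.inv_eq_right_inv
    rw [genKZD, Matrix.diagonal_mul_diagonal, ← Matrix.diagonal_one]
    congr 1
    funext i
    fin_cases i <;> simp [hz]
  rw [hinv]
  unfold genKZD genKZA₁ genKZA₂
  rw [hswap]
  generalize z₁ - z₂ = w at hz
  constructor
  · ext i j
    rw [Matrix.mul_diagonal, Matrix.diagonal_mul]
    fin_cases i <;> fin_cases j <;> simp <;> field_simp
  · ext i j
    rw [Matrix.mul_diagonal, Matrix.diagonal_mul]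
    fin_cases i <;> fin_cases j <;> simp <;> field_simp <;> ring
end

section
/- Fix α, h ∈ ℂ. For z₁ ≠ z₂ in ℂ let A₁(z₁,z₂) be the 4×4 complex matrix (rows/columns indexed 1–4) whose only nonzero entries are A₁[1,3]=1, A₁[2,4]=1, A₁[3,1]=αh/(z₁−z₂)², A₁[3,2]=α/(z₁−z₂), A₁[4,1]=(α+2)αh/(z₁−z₂)³, A₁[4,2]=α(h+1)/(z₁−z₂)², A₁[4,3]=−α²/(z₁−z₂)², and let D(z₁,z₂) := diag(1, z₁−z₂, z₁−z₂, (z₁−z₂)²), whose partial derivative with respect to z₁ is ∂₁D = diag(0, 1, 1, 2(z₁−z₂)). Then the gauge-transformed connection matrix B(z₁,z₂) := D·A₁·D⁻¹ − (∂₁D)·D⁻¹ satisfies (z₁−z₂)·B(z₁,z₂) = R for all z₁ ≠ z₂, where R is the constant matrix with nonzero entries R[1,3]=1, R[2,2]=−1, R[2,4]=1, R[3,1]=αh, R[3,2]=α, R[3,3]=−1, R[4,1]=α(α+2)h, R[4,2]=α(h+1), R[4,3]=−α², R[4,4]=−2. In particular, B has exactly a first-order pole at z₁ = z₂ with residue independent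 of (z₁,z₂). -/
/-- The partial derivative of `genKZD` with respect to `z₁`. -/
noncomputable def genKZD' (z₁ z₂ : ℂ) : Matrix (Fin 4) (Fin 4) ℂ :=
  Matrix.diagonal ![0, 1, 1, 2 * (z₁ - z₂)]

/-- The gauge-transformed connection term `B = D A₁ D⁻¹ - (∂₁D) D⁻¹` has exactly a
first-order pole at `z₁ = z₂` with constant residue matrix `R` (Proposition 3 of the
paper, realized concretely): `(z₁ - z₂) • B = R` for all `z₁ ≠ z₂`. -/
theorem genKZ_gauge_transformed_connection_residue (α h : ℂ) :
    ∀ z₁ z₂ : ℂ, z₁ ≠ z₂ →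
      (z₁ - z₂) •
          (genKZD z₁ z₂ * genKZA₁ α h z₁ z₂ * (genKZD z₁ z₂)⁻¹
            - genKZD' z₁ z₂ * (genKZD z₁ z₂)⁻¹)
        = !![0, 0, 1, 0;
             0, -1, 0, 1;
             α * h, α, -1, 0;
             α * (α + 2) * h, α * (h + 1), -α ^ 2, -2] := by
  intro z₁ z₂ hz
  have hw : z₁ - z₂ ≠ 0 := sub_ne_zero.mpr hz
  have hinv : (genKZD z₁ z₂)⁻¹ =
      Matrix.diagonal ![1, (z₁ - z₂)⁻¹, (z₁ - z₂)⁻¹, ((z₁ - z₂) ^ 2)⁻¹] := by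
    apply Matrix.inv_eq_right_inv
    rw [genKZD, Matrix.diagonal_mul_diagonal, ← Matrix.diagonal_one]
    congr 1
    funext i
    fin_cases i <;> simp [hw]
  rw [hinv, genKZD, genKZD', genKZA₁]
  generalize z₁ - z₂ = w at hw
  ext i j
  rw [Matrix.smul_apply, Matrix.sub_apply, Matrix.mul_diagonal, Matrix.diagonal_mul,
    Matrix.mul_diagonal]
  fin_cases i <;> fin_cases j <;> simp [Matrix.diagonal_apply] <;> field_simp
end

section
/- Fix h ∈ ℂ and set α := 2(2h+1)/3. For z₁ ≠ z₂ in ℂ let A₁(z₁,z₂) and A₂(z₁,z₂) be the 4×4 complex matrices (rows/columns indexed 1–4) whose only nonzero entries are: A₁[1,3]=1, A₁[2,4]=1, A₁[3,1]=αh/(z₁−z₂)², A₁[3,2]=α/(z₁−z₂), A₁[4,1]=(α+2)αh/(z₁−z₂)³, A₁[4,2]=α(h+1)/(z₁−z₂)², A₁[4,3]=−α²/(z₁−z₂)²; and A₂[1,2]=1, A₂[2,1]=αh/(z₂−z₁)², A₂[2,3]=α/(z₂−z₁), A₂[3,4]=1, A₂[4,1]=(α+2)αh/(z₂−z₁)³,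 A₂[4,2]=−α²/(z₂−z₁)², A₂[4,3]=α(h+1)/(z₂−z₁)². Then the connection ∇ᵢ = ∂ᵢ − Aᵢ is flat on {z₁ ≠ z₂}: the matrix-valued maps A₁, A₂ are differentiable there and satisfy the zero-curvature equation ∂A₂/∂z₁ − ∂A₁/∂z₂ = A₁·A₂ − A₂·A₁ (entrywise partial derivatives, matrix product). -/
set_option maxHeartbeats 4000000

theorem kz_hasDeriv_left (c a b : ℂ) (n : ℕ) (hab : a - b ≠ 0) :
    HasDerivAt (fun w : ℂ => c / (w - b) ^ n) (-(n * c) / (a - b) ^ (n + 1)) a := by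
  have h1 : HasDerivAt (fun w : ℂ => (w - b) ^ n) (n * (a - b) ^ (n - 1) * 1) a :=
    ((hasDerivAt_id a).sub_const b).pow n
  have h2 := (hasDerivAt_const a c).div h1 (pow_ne_zero n hab)
  refine HasDerivAt.congr_deriv h2 ?_
  cases n with
  | zero => simp
  | succ m =>
    simp only [Nat.add_sub_cancel]
    field_simp
    ring

theorem kz_hasDeriv_right (c a b : ℂ) (n : ℕ) (hab : b - a ≠ 0) :
    HasDerivAt (fun w : ℂ => c / (b - w) ^ n) ((n * c) / (b - a) ^ (n + 1)) a := by
  have h1 : HasDerivAt (fun w : ℂ => (b - w) ^ n) (n * (b - a) ^ (n - 1) * (-1)) a :=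
    ((hasDerivAt_id a).const_sub b).pow n
  have h2 := (hasDerivAt_const a c).div h1 (pow_ne_zero n hab)
  refine HasDerivAt.congr_deriv h2 ?_
  cases n with
  | zero => simp
  | succ m =>
    simp only [Nat.add_sub_cancel]
    field_simp
    ring

/-- Flatness (zero curvature) of the generalized KZ connection `∇ᵢ = ∂ᵢ - Aᵢ` for the
two-point blocks of two Virasoro `(2,1)`-modules of weight `h`, with
`α = 2(2h+1)/3` (the `N = 2` Virasoro instance of Proposition 2 of the paper):
on `{z₁ ≠ z₂}` all entries of `A₁, A₂` are differentiable in each variable and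
`∂₁A₂ - ∂₂A₁ = A₁A₂ - A₂A₁`. -/
theorem genKZ_connection_flat (h α : ℂ) (hα : α = 2 * (2 * h + 1) / 3) :
    ∀ z₁ z₂ : ℂ, z₁ ≠ z₂ →
      (∀ i j : Fin 4,
        DifferentiableAt ℂ (fun w => genKZA₁ α h w z₂ i j) z₁ ∧
        DifferentiableAt ℂ (fun w => genKZA₁ α h z₁ w i j) z₂ ∧
        DifferentiableAt ℂ (fun w => genKZA₂ α h w z₂ i j) z₁ ∧
        DifferentiableAt ℂ (fun w => genKZA₂ α h z₁ w i j) z₂) ∧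
      (∀ i j : Fin 4,
        deriv (fun w => genKZA₂ α h w z₂ i j) z₁
            - deriv (fun w => genKZA₁ α h z₁ w i j) z₂
          = (genKZA₁ α h z₁ z₂ * genKZA₂ α h z₁ z₂
              - genKZA₂ α h z₁ z₂ * genKZA₁ α h z₁ z₂) i j) := by
  intro z₁ z₂ hz
  have hd : z₁ - z₂ ≠ 0 := sub_ne_zero.mpr hz
  have hd' : z₂ - z₁ ≠ 0 := sub_ne_zero.mpr hz.symm
  have L := fun (c : ℂ) (n : ℕ) => (kz_hasDeriv_left c z₁ z₂ n hd)
  have L' := fun (c : ℂ) (n : ℕ) => (kz_hasDeriv_left c z₂ z₁ n hd')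
  have R := fun (c : ℂ) (n : ℕ) => (kz_hasDeriv_right c z₁ z₂ n hd')
  have R' := fun (c : ℂ) (n : ℕ) => (kz_hasDeriv_right c z₂ z₁ n hd)
  have R1 : deriv (fun w : ℂ => α / (z₂ - w)) z₁ = α / (z₂ - z₁) ^ 2 := by
    simpa using (R α 1).deriv
  have R1' : deriv (fun w : ℂ => α / (z₁ - w)) z₂ = α / (z₁ - z₂) ^ 2 := by
    simpa using (R' α 1).deriv
  have DL : DifferentiableAt ℂ (fun w : ℂ => α / (w - z₂)) z₁ := by
    simpa using (L α 1).differentiableAt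
  have DR' : DifferentiableAt ℂ (fun w : ℂ => α / (z₁ - w)) z₂ := by
    simpa using (R' α 1).differentiableAt
  have DR : DifferentiableAt ℂ (fun w : ℂ => α / (z₂ - w)) z₁ := by
    simpa using (R α 1).differentiableAt
  have DL' : DifferentiableAt ℂ (fun w : ℂ => α / (w - z₁)) z₂ := by
    simpa using (L' α 1).differentiableAt
  have key : z₂ - z₁ = -(z₁ - z₂) := by ring
  have hh : h = (3 * α - 2) / 4 := by rw [hα]; ring
  constructor
  · intro i j
    refine ⟨?_, ?_, ?_, ?_⟩
    · fin_cases i <;> fin_cases j <;> simp [genKZA₁] <;>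
        first
        | (with_reducible exact DL)
        | (with_reducible exact (L _ 2).differentiableAt)
        | (with_reducible exact (L _ 3).differentiableAt)
    · fin_cases i <;> fin_cases j <;> simp [genKZA₁] <;>
        first
        | (with_reducible exact DR')
        | (with_reducible exact (R' _ 2).differentiableAt)
        | (with_reducible exact (R' _ 3).differentiableAt)
    · fin_cases i <;> fin_cases j <;> simp [genKZA₂] <;>
        first
        | (with_reducible exact DR)
        | (with_reducible exact (R _ 2).differentiableAt)
        | (with_reducible exact (R _ 3).differentiableAt)
    · fin_cases i <;> fin_cases j <;> simp [genKZA₂] <;>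
        first
        | (with_reducible exact DL')
        | (with_reducible exact (L' _ 2).differentiableAt)
        | (with_reducible exact (L' _ 3).differentiableAt)
  · intro i j
    fin_cases i <;> fin_cases j <;>
      simp [genKZA₁, genKZA₂, -deriv_div_const,
        -deriv_const_mul_field', (R _ _).deriv, (R' _ _).deriv, R1, R1'] <;>
      (try rw [key]) <;> generalize z₁ - z₂ = d at hd <;> subst hh <;> field_simp <;> ring
end
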